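/- Let 𝒞 = −∫₀¹ (log s)/(1+s²) ds (the Catalan constant). Then 2·e^{−2𝒞/π}/(9π²) ≤ ∫₀^∞ (r(x))² dx ≤ Γ(3/4)²/(π·Γ(1/4)²). (In particular 0.012 < ∫₀^∞ r² < 0.037.) -/

import Mathlib

open Real MeasureTheory Set

/-- `η t = (1/4)·log(1+t²) − (1/π)·∫₀^t log|s|/(1+s²) ds`. -/
noncomputable def etaF (t : ℝ) : ℝ :=
  Real.log (1 + t ^ 2) / 4 - (1 / Real.pi) * ∫ s in (0 : ℝ)..t, Real.log |s| / (1 + s ^ 2)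

/-- The remainder term `r`. -/
noncomputable def rfun (x : ℝ) : ℝ :=
  (Real.sqrt 2 / (2 * Real.pi)) *
    ∫ t in Ioi (0 : ℝ), (t / (1 + t ^ 2)) * Real.exp (-etaF t) * Real.exp (-t * x)

/-- The Catalan constant `𝒞 = −∫₀¹ log s/(1+s²) ds`. -/
noncomputable def catalanC : ℝ := -∫ s in (0 : ℝ)..1, Real.log s / (1 + s ^ 2)

lemma intervalIntegrable_log_abs_div (a b : ℝ) :
    IntervalIntegrable (fun s : ℝ => Real.log |s| / (1 + s ^ 2)) volume a b := by
  simp_rw [Real.log_abs, div_eq_mul_inv]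
  refine intervalIntegral.intervalIntegrable_log'.mul_continuousOn (Continuous.continuousOn ?_)
  exact Continuous.inv₀ (by fun_prop) fun s => by positivity

lemma continuous_etaF : Continuous etaF := by
  have h := intervalIntegral.continuous_primitive intervalIntegrable_log_abs_div 0
  have h2 : Continuous fun t : ℝ => Real.log (1 + t ^ 2) :=
    Continuous.log (by fun_prop) fun t => by positivity
  unfold etaF
  fun_prop

lemma integral_log_abs_div_zero_one :
    ∫ s in (0 : ℝ)..1, Real.log |s| / (1 + s ^ 2) = -catalanC := by
  simp [catalanC]

lemma integral_log_abs_div_nonpos {a b : ℝ} (ha : 0 ≤ a) (hab : a ≤ b) (hb : b ≤ 1) :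
    ∫ s in a..b, Real.log |s| / (1 + s ^ 2) ≤ 0 := by
  have h := intervalIntegral.integral_nonneg (μ := volume)
    (f := fun s : ℝ => -(Real.log |s| / (1 + s ^ 2))) hab
    (fun s hs => by
      rw [← neg_div, Real.log_abs]
      have := Real.log_nonpos (ha.trans hs.1) (hs.2.trans hb)
      exact div_nonneg (by linarith) (by positivity))
  rw [intervalIntegral.integral_neg] at h
  linarith

lemma integral_log_abs_div_inv {t : ℝ} (ht : 1 ≤ t) :
    ∫ s in (0 : ℝ)..t, Real.log |s| / (1 + s ^ 2) =
      ∫ s in (0 : ℝ)..t⁻¹, Real.log |s| / (1 + s ^ 2) := by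
  have hpos : ∀ s ∈ uIcc 1 t, 0 < s := fun s hs => by
    rw [uIcc_of_le ht] at hs
    linarith [hs.1]
  have h := intervalIntegral.integral_comp_mul_deriv''
    (a := 1) (b := t) (f := fun s : ℝ => s⁻¹) (f' := fun s => -(s ^ 2)⁻¹)
    (g := fun s : ℝ => Real.log |s| / (1 + s ^ 2))
    (continuousOn_inv₀.mono fun s hs => (hpos s hs).ne')
    (fun s hs => (hasDerivAt_inv (hpos s ⟨hs.1.le, hs.2.le⟩).ne').hasDerivWithinAt)
    (fun s hs => ContinuousAt.continuousWithinAt (by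
      have := (hpos s hs).ne'
      fun_prop (disch := positivity)))
    (by
      rintro _ ⟨s, hs, rfl⟩
      have := inv_pos.2 (hpos s hs)
      refine ContinuousAt.continuousWithinAt ?_
      fun_prop (disch := positivity))
  have h2 : ∫ s in (1 : ℝ)..t, ((fun s : ℝ => Real.log |s| / (1 + s ^ 2)) ∘ fun s => s⁻¹) s *
      -(s ^ 2)⁻¹ = ∫ s in (1 : ℝ)..t, Real.log |s| / (1 + s ^ 2) := by
    refine intervalIntegral.integral_congr fun s hs => ?_
    have := hpos s hs
    simp only [Function.comp_apply, Real.log_abs, Real.log_inv]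
    field_simp
    ring
  rw [← intervalIntegral.integral_add_adjacent_intervals
      (intervalIntegrable_log_abs_div 0 1) (intervalIntegrable_log_abs_div 1 t),
    ← intervalIntegral.integral_add_adjacent_intervals
      (intervalIntegrable_log_abs_div 0 1) (intervalIntegrable_log_abs_div 1 t⁻¹), ← h2, h, inv_one]

lemma integral_log_abs_div_mem_Icc {t : ℝ} (ht : 0 < t) :
    ∫ s in (0 : ℝ)..t, Real.log |s| / (1 + s ^ 2) ∈ Icc (-catalanC) 0 := by
  have key : ∀ u : ℝ, 0 < u → u ≤ 1 →
      ∫ s in (0 : ℝ)..u, Real.log |s| / (1 + s ^ 2) ∈ Icc (-catalanC) 0 := by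
    intro u hu hu1
    refine ⟨?_, integral_log_abs_div_nonpos le_rfl hu.le hu1⟩
    rw [← integral_log_abs_div_zero_one, ← intervalIntegral.integral_add_adjacent_intervals
      (intervalIntegrable_log_abs_div 0 u) (intervalIntegrable_log_abs_div u 1)]
    linarith [integral_log_abs_div_nonpos hu.le hu1 le_rfl]
  rcases le_total t 1 with h | h
  · exact key t ht h
  · rw [integral_log_abs_div_inv h]
    exact key _ (inv_pos.2 ht) (inv_le_one_of_one_le₀ h)

lemma exp_neg_etaF (t : ℝ) :
    Real.exp (-etaF t) = (1 + t ^ 2) ^ (-(1 / 4) : ℝ) *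
      Real.exp ((∫ s in (0 : ℝ)..t, Real.log |s| / (1 + s ^ 2)) / Real.pi) := by
  rw [Real.rpow_def_of_pos (by positivity), ← Real.exp_add, etaF]
  ring_nf

lemma exp_neg_etaF_le {t : ℝ} (ht : 0 < t) :
    Real.exp (-etaF t) ≤ (1 + t ^ 2) ^ (-(1 / 4) : ℝ) := by
  rw [exp_neg_etaF]
  refine mul_le_of_le_one_right (by positivity) (Real.exp_le_one_iff.2 ?_)
  exact div_nonpos_of_nonpos_of_nonneg (integral_log_abs_div_mem_Icc ht).2 Real.pi_pos.le

lemma le_exp_neg_etaF {t : ℝ} (ht : 0 < t) :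
    (1 + t ^ 2) ^ (-(1 / 4) : ℝ) * Real.exp (-catalanC / Real.pi) ≤ Real.exp (-etaF t) := by
  rw [exp_neg_etaF]
  have := (integral_log_abs_div_mem_Icc ht).1
  gcongr

/-- The density whose Laplace transform is proportional to `rfun`. -/
noncomputable def laplaceDensity (t : ℝ) : ℝ := t / (1 + t ^ 2) * Real.exp (-etaF t)

lemma continuous_laplaceDensity : Continuous laplaceDensity := by
  have := continuous_etaF
  unfold laplaceDensity
  exact (continuous_id.div (by fun_prop) fun t => by positivity).mul (by fun_prop)

lemma laplaceDensity_nonneg {t : ℝ} (ht : 0 < t) : 0 ≤ laplaceDensity t := by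
  unfold laplaceDensity
  positivity

lemma laplaceDensity_le {t : ℝ} (ht : 0 < t) :
    laplaceDensity t ≤ t * (1 + t ^ 2) ^ (-(5 / 4) : ℝ) := by
  have h : (1 + t ^ 2) ^ (-(5 / 4) : ℝ) = (1 + t ^ 2)⁻¹ * (1 + t ^ 2) ^ (-(1 / 4) : ℝ) := by
    rw [← Real.rpow_neg_one, ← Real.rpow_add (by positivity)]
    norm_num
  rw [h, laplaceDensity, ← mul_assoc, ← div_eq_mul_inv]
  have := exp_neg_etaF_le ht
  gcongr

lemma le_laplaceDensity {t : ℝ} (ht : 0 < t) :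
    Real.exp (-catalanC / Real.pi) * (t * (1 + t ^ 2) ^ (-(7 / 4) : ℝ)) * √(1 + t ^ 2) ≤
      laplaceDensity t := by
  have h : (1 + t ^ 2) ^ (-(7 / 4) : ℝ) * √(1 + t ^ 2) =
      (1 + t ^ 2)⁻¹ * (1 + t ^ 2) ^ (-(1 / 4) : ℝ) := by
    rw [Real.sqrt_eq_rpow, ← Real.rpow_neg_one, ← Real.rpow_add (by positivity),
      ← Real.rpow_add (by positivity)]
    norm_num
  calc _ = t / (1 + t ^ 2) * ((1 + t ^ 2) ^ (-(1 / 4) : ℝ) *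
        Real.exp (-catalanC / Real.pi)) := by
        rw [show ∀ a b c d : ℝ, a * (b * c) * d = a * b * (c * d) by intros; ring, h]
        ring
    _ ≤ _ := by
        have := le_exp_neg_etaF ht
        unfold laplaceDensity
        gcongr

lemma laplaceDensity_le_sqrt {t : ℝ} (ht : 0 < t) :
    laplaceDensity t ≤ t ^ (1 / 2 : ℝ) * (1 + t ^ 2) ^ (-(5 / 4) : ℝ) * √t := by
  refine (laplaceDensity_le ht).trans (le_of_eq ?_)
  rw [← Real.sqrt_eq_rpow, mul_right_comm, Real.mul_self_sqrt ht.le]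

lemma laplaceDensity_mul_le {t s : ℝ} (ht : 0 < t) (hs : 0 < s) :
    laplaceDensity t * laplaceDensity s * (t + s)⁻¹ ≤
      1 / 2 * (t ^ (1 / 2 : ℝ) * (1 + t ^ 2) ^ (-(5 / 4) : ℝ)) *
        (s ^ (1 / 2 : ℝ) * (1 + s ^ 2) ^ (-(5 / 4) : ℝ)) := by
  have h1 := laplaceDensity_le_sqrt ht
  have h2 := laplaceDensity_le_sqrt hs
  rw [← div_eq_mul_inv, div_le_iff₀ (by positivity)]
  set a := t ^ (1 / 2 : ℝ) * (1 + t ^ 2) ^ (-(5 / 4) : ℝ)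
  set b := s ^ (1 / 2 : ℝ) * (1 + s ^ 2) ^ (-(5 / 4) : ℝ)
  have ha : 0 ≤ a := by positivity
  have hb : 0 ≤ b := by positivity
  have h3 : √t * √s ≤ (t + s) / 2 := by
    nlinarith [sq_nonneg (√t - √s), Real.sq_sqrt ht.le, Real.sq_sqrt hs.le]
  calc laplaceDensity t * laplaceDensity s ≤ (a * √t) * (b * √s) :=
        mul_le_mul h1 h2 (laplaceDensity_nonneg hs) (by positivity)
    _ = (a * b) * (√t * √s) := by ring
    _ ≤ (a * b) * ((t + s) / 2) := by gcongr
    _ = _ := by ring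

lemma le_laplaceDensity_mul {t s : ℝ} (ht : 0 < t) (hs : 0 < s) :
    Real.exp (-2 * catalanC / Real.pi) * (t * (1 + t ^ 2) ^ (-(7 / 4) : ℝ)) *
        (s * (1 + s ^ 2) ^ (-(7 / 4) : ℝ)) ≤
      laplaceDensity t * laplaceDensity s * (t + s)⁻¹ := by
  have h1 := le_laplaceDensity ht
  have h2 := le_laplaceDensity hs
  rw [← div_eq_mul_inv, le_div_iff₀ (by positivity)]
  have hk : Real.exp (-2 * catalanC / Real.pi) =
      Real.exp (-catalanC / Real.pi) * Real.exp (-catalanC / Real.pi) := by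
    rw [← Real.exp_add]
    ring_nf
  rw [hk]
  set k := Real.exp (-catalanC / Real.pi)
  set a := t * (1 + t ^ 2) ^ (-(7 / 4) : ℝ)
  set b := s * (1 + s ^ 2) ^ (-(7 / 4) : ℝ)
  have hkp : 0 ≤ k := by positivity
  have ha : 0 ≤ a := by positivity
  have hb : 0 ≤ b := by positivity
  have h3 : t + s ≤ √(1 + t ^ 2) * √(1 + s ^ 2) := by
    rw [← Real.sqrt_mul (by positivity)]
    exact Real.le_sqrt_of_sq_le (by nlinarith [sq_nonneg (1 - t * s)])
  calc k * k * a * b * (t + s) ≤ k * k * a * b * (√(1 + t ^ 2) * √(1 + s ^ 2)) := by gcongr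
    _ = (k * a * √(1 + t ^ 2)) * (k * b * √(1 + s ^ 2)) := by ring
    _ ≤ _ := mul_le_mul h1 h2 (by positivity) (laplaceDensity_nonneg ht)

lemma lintegral_ofReal_of_integral_eq {μ : Measure ℝ} {f : ℝ → ℝ} {c : ℝ} (hf : 0 ≤ᵐ[μ] f)
    (h : ∫ x, f x ∂μ = c) (hc : c ≠ 0) :
    ∫⁻ x, ENNReal.ofReal (f x) ∂μ = ENNReal.ofReal c := by
  rw [← h, ofReal_integral_eq_lintegral_ofReal (.of_integral_ne_zero (h ▸ hc)) hf]

lemma lintegral_mul_one_add_sq_rpow {p : ℝ} (hp : 0 < p) :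
    ∫⁻ t in Ioi (0 : ℝ), ENNReal.ofReal (t * (1 + t ^ 2) ^ (-(1 + p))) =
      ENNReal.ofReal (1 / (2 * p)) := by
  refine lintegral_ofReal_of_integral_eq ?_ ?_ (by positivity)
  · filter_upwards [ae_restrict_mem measurableSet_Ioi] with t ht
    have : (0 : ℝ) < t := ht
    simp only [Pi.zero_apply]
    positivity
  · have hlim : Filter.Tendsto (fun t : ℝ => -(1 / (2 * p)) * (1 + t ^ 2) ^ (-p)) Filter.atTop
        (nhds (-(1 / (2 * p)) * 0)) :=
      ((tendsto_rpow_neg_atTop hp).comp (Filter.tendsto_atTop_add_const_left _ 1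
        (Filter.tendsto_pow_atTop two_ne_zero))).const_mul _
    rw [integral_Ioi_of_hasDerivAt_of_nonneg' (fun t _ => ?_) (fun t ht => ?_) hlim]
    · simp
    · have h1 : HasDerivAt (fun t : ℝ => 1 + t ^ 2) (2 * t) t := by
        simpa using (hasDerivAt_pow 2 t).const_add 1
      have h2 := (h1.rpow_const (p := -p) (Or.inl (by positivity))).const_mul (-(1 / (2 * p)))
      refine h2.congr_deriv ?_
      rw [show -p - 1 = -(1 + p) by ring]
      field_simp
    · have : (0 : ℝ) < t := ht
      positivity

lemma lintegral_rpow_mul_exp_neg_mul {a r : ℝ} (ha : 0 < a) (hr : 0 < r) :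
    ∫⁻ u in Ioi (0 : ℝ), ENNReal.ofReal (u ^ (a - 1) * Real.exp (-(r * u))) =
      ENNReal.ofReal ((1 / r) ^ a * Real.Gamma a) := by
  have := Real.Gamma_pos_of_pos ha
  refine lintegral_ofReal_of_integral_eq ?_ (Real.integral_rpow_mul_exp_neg_mul_Ioi ha hr)
    (by positivity)
  filter_upwards [ae_restrict_mem measurableSet_Ioi] with t ht
  have : (0 : ℝ) < t := ht
  simp only [Pi.zero_apply]
  positivity

lemma lintegral_rpow_mul_exp_neg_mul_sq {q b : ℝ} (hq : -1 < q) (hb : 0 < b) :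
    ∫⁻ t in Ioi (0 : ℝ), ENNReal.ofReal (t ^ q * Real.exp (-b * t ^ 2)) =
      ENNReal.ofReal (b ^ (-(q + 1) / 2) * (1 / 2) * Real.Gamma ((q + 1) / 2)) := by
  have := Real.Gamma_pos_of_pos (s := (q + 1) / 2) (by linarith)
  refine lintegral_ofReal_of_integral_eq ?_ ?_ (by positivity)
  · filter_upwards [ae_restrict_mem measurableSet_Ioi] with t ht
    have : (0 : ℝ) < t := ht
    simp only [Pi.zero_apply]
    positivity
  · have h := integral_rpow_mul_exp_neg_mul_rpow (p := 2) two_pos hq hb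
    simpa only [Real.rpow_two] using h

lemma lintegral_sqrt_mul_one_add_sq_rpow :
    ∫⁻ t in Ioi (0 : ℝ), ENNReal.ofReal (t ^ (1 / 2 : ℝ) * (1 + t ^ 2) ^ (-(5 / 4) : ℝ)) =
      ENNReal.ofReal (2 * √Real.pi * Real.Gamma (3 / 4) / Real.Gamma (1 / 4)) := by
  have hG4 : Real.Gamma (5 / 4) = 1 / 4 * Real.Gamma (1 / 4) := by
    rw [← Real.Gamma_add_one (by norm_num)]
    norm_num
  have hGp : 0 < Real.Gamma (1 / 4) := Real.Gamma_pos_of_pos (by norm_num)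
  have hG3 : 0 < Real.Gamma (3 / 4) := Real.Gamma_pos_of_pos (by norm_num)
  have hG5 : 0 < Real.Gamma (5 / 4) := Real.Gamma_pos_of_pos (by norm_num)
  have hne : ENNReal.ofReal (Real.Gamma (5 / 4)) ≠ 0 := by simpa using hG5
  have hmul : ENNReal.ofReal (Real.Gamma (5 / 4)) *
      ∫⁻ t in Ioi (0 : ℝ), ENNReal.ofReal (t ^ (1 / 2 : ℝ) * (1 + t ^ 2) ^ (-(5 / 4) : ℝ)) =
      ENNReal.ofReal (1 / 2 * Real.Gamma (3 / 4) * √Real.pi) := by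
    rw [← lintegral_const_mul _ (by fun_prop)]
    calc _ = ∫⁻ t in Ioi (0 : ℝ), ∫⁻ u in Ioi (0 : ℝ), ENNReal.ofReal
          (t ^ (1 / 2 : ℝ) * (u ^ ((5 / 4 : ℝ) - 1) * Real.exp (-((1 + t ^ 2) * u)))) := by
          refine setLIntegral_congr_fun measurableSet_Ioi fun t ht => ?_
          have ht : (0 : ℝ) < t := ht
          simp_rw [ENNReal.ofReal_mul (p := t ^ (1 / 2 : ℝ)) (by positivity)]
          rw [lintegral_const_mul _ (by fun_prop),
            lintegral_rpow_mul_exp_neg_mul (by norm_num) (by positivity),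
            ← ENNReal.ofReal_mul (by positivity), ← ENNReal.ofReal_mul (by positivity),
            ← ENNReal.ofReal_mul (by positivity), Real.rpow_neg (by positivity),
            Real.div_rpow (by positivity) (by positivity), Real.one_rpow]
          ring_nf
      _ = ∫⁻ u in Ioi (0 : ℝ), ∫⁻ t in Ioi (0 : ℝ), ENNReal.ofReal
          (t ^ (1 / 2 : ℝ) * (u ^ ((5 / 4 : ℝ) - 1) * Real.exp (-((1 + t ^ 2) * u)))) := by
          refine lintegral_lintegral_swap (Measurable.aemeasurable ?_)
          unfold Function.uncurry
          fun_prop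
      _ = ∫⁻ u in Ioi (0 : ℝ), ENNReal.ofReal (1 / 2 * Real.Gamma (3 / 4)) *
          ENNReal.ofReal (u ^ ((1 / 2 : ℝ) - 1) * Real.exp (-(1 * u))) := by
          refine setLIntegral_congr_fun measurableSet_Ioi fun u hu => ?_
          have hu : (0 : ℝ) < u := hu
          have h1 : ∀ t : ℝ, t ^ (1 / 2 : ℝ) * (u ^ ((5 / 4 : ℝ) - 1) *
              Real.exp (-((1 + t ^ 2) * u))) = u ^ ((5 / 4 : ℝ) - 1) * Real.exp (-u) *
              (t ^ (1 / 2 : ℝ) * Real.exp (-u * t ^ 2)) := fun t => by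
            rw [show -((1 + t ^ 2) * u) = -u + -u * t ^ 2 by ring, Real.exp_add]
            ring
          simp_rw [h1]
          have h2 : ∀ t : ℝ, ENNReal.ofReal (u ^ ((5 / 4 : ℝ) - 1) * Real.exp (-u) *
              (t ^ (1 / 2 : ℝ) * Real.exp (-u * t ^ 2))) =
              ENNReal.ofReal (u ^ ((5 / 4 : ℝ) - 1) * Real.exp (-u)) *
              ENNReal.ofReal (t ^ (1 / 2 : ℝ) * Real.exp (-u * t ^ 2)) := fun t =>
            ENNReal.ofReal_mul (by positivity)
          simp_rw [h2]
          rw [lintegral_const_mul _ (by fun_prop),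
            lintegral_rpow_mul_exp_neg_mul_sq (by norm_num) hu,
            ← ENNReal.ofReal_mul (by positivity), ← ENNReal.ofReal_mul (by positivity)]
          have h3 : u ^ ((1 / 2 : ℝ) - 1) =
              u ^ ((5 / 4 : ℝ) - 1) * u ^ (-((1 / 2 : ℝ) + 1) / 2) := by
            rw [← Real.rpow_add hu]
            norm_num
          rw [h3]
          norm_num
          ring_nf
      _ = _ := by
          rw [lintegral_const_mul _ (by fun_prop),
            lintegral_rpow_mul_exp_neg_mul (by norm_num) (by norm_num),
            ← ENNReal.ofReal_mul (by positivity), Real.Gamma_one_half_eq]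
          norm_num
  have hfin : ENNReal.ofReal (Real.Gamma (5 / 4)) *
      ENNReal.ofReal (2 * √Real.pi * Real.Gamma (3 / 4) / Real.Gamma (1 / 4)) =
      ENNReal.ofReal (1 / 2 * Real.Gamma (3 / 4) * √Real.pi) := by
    rw [← ENNReal.ofReal_mul hG5.le, hG4]
    congr 1
    field_simp
    ring
  exact (ENNReal.mul_right_inj hne ENNReal.ofReal_ne_top).1 (hmul.trans hfin.symm)

lemma lintegral_ofReal_exp_neg_mul {a : ℝ} (ha : 0 < a) :
    ∫⁻ x in Ioi (0 : ℝ), ENNReal.ofReal (Real.exp (-a * x)) = ENNReal.ofReal a⁻¹ := by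
  refine lintegral_ofReal_of_integral_eq (.of_forall fun x => (Real.exp_pos _).le) ?_
    (by positivity)
  rw [integral_exp_mul_Ioi (by linarith)]
  simp [div_neg, neg_div]

lemma lintegral_laplace_sq :
    ∫⁻ x in Ioi (0 : ℝ), (∫⁻ t in Ioi (0 : ℝ),
        ENNReal.ofReal (laplaceDensity t * Real.exp (-t * x))) ^ 2 =
      ∫⁻ t in Ioi (0 : ℝ), ∫⁻ s in Ioi (0 : ℝ),
        ENNReal.ofReal (laplaceDensity t * laplaceDensity s * (t + s)⁻¹) := by
  have hm : Measurable laplaceDensity := continuous_laplaceDensity.measurable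
  calc _ = ∫⁻ x in Ioi (0 : ℝ), ∫⁻ t in Ioi (0 : ℝ), ∫⁻ s in Ioi (0 : ℝ),
        ENNReal.ofReal (laplaceDensity t * Real.exp (-t * x)) *
          ENNReal.ofReal (laplaceDensity s * Real.exp (-s * x)) := by
        refine lintegral_congr fun x => ?_
        rw [sq, ← lintegral_mul_const _ (by fun_prop)]
        refine lintegral_congr fun t => ?_
        rw [lintegral_const_mul _ (by fun_prop)]
    _ = ∫⁻ t in Ioi (0 : ℝ), ∫⁻ x in Ioi (0 : ℝ), ∫⁻ s in Ioi (0 : ℝ),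
        ENNReal.ofReal (laplaceDensity t * Real.exp (-t * x)) *
          ENNReal.ofReal (laplaceDensity s * Real.exp (-s * x)) := by
        refine lintegral_lintegral_swap (Measurable.aemeasurable ?_)
        unfold Function.uncurry
        exact Measurable.lintegral_prod_right (by unfold Function.uncurry; fun_prop)
    _ = ∫⁻ t in Ioi (0 : ℝ), ∫⁻ s in Ioi (0 : ℝ), ∫⁻ x in Ioi (0 : ℝ),
        ENNReal.ofReal (laplaceDensity t * Real.exp (-t * x)) *
          ENNReal.ofReal (laplaceDensity s * Real.exp (-s * x)) := by
        refine lintegral_congr fun t => ?_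
        refine lintegral_lintegral_swap (Measurable.aemeasurable ?_)
        unfold Function.uncurry
        fun_prop
    _ = _ := by
        refine setLIntegral_congr_fun measurableSet_Ioi fun t ht => ?_
        refine setLIntegral_congr_fun measurableSet_Ioi fun s hs => ?_
        have ht : (0 : ℝ) < t := ht
        have hs : (0 : ℝ) < s := hs
        have h1 := laplaceDensity_nonneg ht
        have h2 := laplaceDensity_nonneg hs
        have h3 : ∀ x : ℝ, ENNReal.ofReal (laplaceDensity t * Real.exp (-t * x)) *
            ENNReal.ofReal (laplaceDensity s * Real.exp (-s * x)) =
            ENNReal.ofReal (laplaceDensity t * laplaceDensity s) *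
              ENNReal.ofReal (Real.exp (-(t + s) * x)) := fun x => by
          rw [← ENNReal.ofReal_mul (by positivity), ← ENNReal.ofReal_mul (by positivity),
            show -(t + s) * x = -t * x + -s * x by ring, Real.exp_add]
          ring_nf
        simp_rw [h3]
        rw [lintegral_const_mul _ (by fun_prop), lintegral_ofReal_exp_neg_mul (by positivity),
          ← ENNReal.ofReal_mul (by positivity)]

lemma lintegral_lintegral_const_mul_mul {c A : ℝ} {f : ℝ → ℝ} (hc : 0 ≤ c) (hA : 0 ≤ A)
    (hf : Measurable f) (hf0 : ∀ t, 0 < t → 0 ≤ f t)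
    (h : ∫⁻ t in Ioi (0 : ℝ), ENNReal.ofReal (f t) = ENNReal.ofReal A) :
    ∫⁻ t in Ioi (0 : ℝ), ∫⁻ s in Ioi (0 : ℝ), ENNReal.ofReal (c * f t * f s) =
      ENNReal.ofReal (c * A ^ 2) := by
  calc _ = ∫⁻ t in Ioi (0 : ℝ), ENNReal.ofReal (f t) * ENNReal.ofReal (c * A) := by
        refine setLIntegral_congr_fun measurableSet_Ioi fun t ht => ?_
        have := hf0 t ht
        simp_rw [ENNReal.ofReal_mul (mul_nonneg hc this)]
        rw [lintegral_const_mul _ (by fun_prop), h, ← ENNReal.ofReal_mul (by positivity),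
          ← ENNReal.ofReal_mul (by positivity)]
        ring_nf
    _ = _ := by
        rw [lintegral_mul_const _ (by fun_prop), h, ← ENNReal.ofReal_mul hA]
        ring_nf

lemma lintegral_laplace_sq_le :
    ∫⁻ x in Ioi (0 : ℝ), (∫⁻ t in Ioi (0 : ℝ),
        ENNReal.ofReal (laplaceDensity t * Real.exp (-t * x))) ^ 2 ≤
      ENNReal.ofReal
        (1 / 2 * (2 * √Real.pi * Real.Gamma (3 / 4) / Real.Gamma (1 / 4)) ^ 2) := by
  have hGp : 0 < Real.Gamma (1 / 4) := Real.Gamma_pos_of_pos (by norm_num)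
  have hG3 : 0 < Real.Gamma (3 / 4) := Real.Gamma_pos_of_pos (by norm_num)
  rw [lintegral_laplace_sq, ← lintegral_lintegral_const_mul_mul (by norm_num) (by positivity)
    (by fun_prop) (fun t ht => by positivity) lintegral_sqrt_mul_one_add_sq_rpow]
  refine setLIntegral_mono' measurableSet_Ioi fun t ht => ?_
  exact setLIntegral_mono' measurableSet_Ioi fun s hs =>
    ENNReal.ofReal_le_ofReal (laplaceDensity_mul_le ht hs)

lemma le_lintegral_laplace_sq :
    ENNReal.ofReal (Real.exp (-2 * catalanC / Real.pi) * (2 / 3) ^ 2) ≤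
      ∫⁻ x in Ioi (0 : ℝ), (∫⁻ t in Ioi (0 : ℝ),
        ENNReal.ofReal (laplaceDensity t * Real.exp (-t * x))) ^ 2 := by
  have h := lintegral_mul_one_add_sq_rpow (p := 3 / 4) (by norm_num)
  norm_num only at h
  rw [lintegral_laplace_sq, ← lintegral_lintegral_const_mul_mul (by positivity) (by norm_num)
    (f := fun t => t * (1 + t ^ 2) ^ (-(7 / 4) : ℝ))
    (by fun_prop) (fun t ht => by positivity) (by norm_num only; exact h)]
  refine setLIntegral_mono' measurableSet_Ioi fun t ht => ?_
  exact setLIntegral_mono' measurableSet_Ioi fun s hs =>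
    ENNReal.ofReal_le_ofReal (le_laplaceDensity_mul ht hs)

lemma lintegral_laplace_lt_top {x : ℝ} (hx : 0 < x) :
    ∫⁻ t in Ioi (0 : ℝ), ENNReal.ofReal (laplaceDensity t * Real.exp (-t * x)) < ⊤ := by
  have h := lintegral_mul_one_add_sq_rpow (p := 1 / 4) (by norm_num)
  norm_num only at h
  refine lt_of_le_of_lt ?_ (h ▸ ENNReal.ofReal_lt_top)
  refine setLIntegral_mono' measurableSet_Ioi fun t ht => ENNReal.ofReal_le_ofReal ?_
  have ht : (0 : ℝ) < t := ht
  refine (mul_le_of_le_one_right (laplaceDensity_nonneg ht) ?_).trans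
    ((laplaceDensity_le ht).trans_eq (by norm_num))
  exact Real.exp_le_one_iff.2 (by nlinarith)

lemma integral_rfun_sq_eq :
    ∫ x in Ioi (0 : ℝ), (rfun x) ^ 2 = 1 / (2 * Real.pi ^ 2) *
      (∫⁻ x in Ioi (0 : ℝ), (∫⁻ t in Ioi (0 : ℝ),
        ENNReal.ofReal (laplaceDensity t * Real.exp (-t * x))) ^ 2).toReal := by
  have hm : Measurable laplaceDensity := continuous_laplaceDensity.measurable
  have hr : ∀ x, rfun x ^ 2 = 1 / (2 * Real.pi ^ 2) *
      ((∫⁻ t in Ioi (0 : ℝ),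
        ENNReal.ofReal (laplaceDensity t * Real.exp (-t * x))) ^ 2).toReal := fun x => by
    have h0 : 0 ≤ᵐ[volume.restrict (Ioi (0 : ℝ))]
        fun t => laplaceDensity t * Real.exp (-t * x) := by
      filter_upwards [ae_restrict_mem measurableSet_Ioi] with t ht
      exact mul_nonneg (laplaceDensity_nonneg ht) (Real.exp_pos _).le
    rw [rfun, mul_pow, ENNReal.toReal_pow,
      ← integral_eq_lintegral_of_nonneg_ae h0 (by fun_prop), div_pow, mul_pow,
      Real.sq_sqrt (by norm_num)]
    unfold laplaceDensity
    congr 1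
    field_simp
  simp_rw [hr]
  rw [integral_const_mul, integral_toReal]
  · refine (Measurable.pow_const ?_ 2).aemeasurable
    exact Measurable.lintegral_prod_right (by unfold Function.uncurry; fun_prop)
  · filter_upwards [ae_restrict_mem measurableSet_Ioi] with x hx
    exact ENNReal.pow_lt_top (lintegral_laplace_lt_top hx)

theorem integral_rfun_sq_bounds :
    2 * Real.exp (-2 * catalanC / Real.pi) / (9 * Real.pi ^ 2)
      ≤ ∫ x in Ioi (0 : ℝ), (rfun x) ^ 2 ∧
    (∫ x in Ioi (0 : ℝ), (rfun x) ^ 2)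
      ≤ (Real.Gamma (3 / 4)) ^ 2 / (Real.pi * (Real.Gamma (1 / 4)) ^ 2) := by
  have hGp : 0 < Real.Gamma (1 / 4) := Real.Gamma_pos_of_pos (by norm_num)
  have hpi := Real.pi_pos
  have hU := lintegral_laplace_sq_le
  have hL := le_lintegral_laplace_sq
  rw [integral_rfun_sq_eq]
  set D := ∫⁻ x in Ioi (0 : ℝ), (∫⁻ t in Ioi (0 : ℝ),
    ENNReal.ofReal (laplaceDensity t * Real.exp (-t * x))) ^ 2
  have hD : D ≠ ⊤ := ne_top_of_le_ne_top ENNReal.ofReal_ne_top hU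
  constructor
  · rw [ENNReal.ofReal_le_iff_le_toReal hD] at hL
    calc _ = 1 / (2 * Real.pi ^ 2) *
          (Real.exp (-2 * catalanC / Real.pi) * (2 / 3) ^ 2) := by
          field_simp
          norm_num
      _ ≤ _ := by gcongr
  · have hU' := ENNReal.toReal_le_of_le_ofReal (by positivity) hU
    calc _ ≤ 1 / (2 * Real.pi ^ 2) *
          (1 / 2 * (2 * √Real.pi * Real.Gamma (3 / 4) / Real.Gamma (1 / 4)) ^ 2) := by gcongr
      _ = _ := by
          rw [div_pow, mul_pow, mul_pow, Real.sq_sqrt hpi.le]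
          field_simp
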